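/- arXiv:2507.23553 — 2 statements merged into one kernel-verified Lean document; each statement's English description precedes it below -/
import Mathlib

section
/- Let d ≥ 1, T > 0, let β : ℝ → ℝ be continuous, and let ṽ : (0,T) × (0,∞) → ℝ be bounded and Borel measurable. Define v(t,x) := ṽ(t, |x|^d) for t ∈ (0,T) and x ∈ ℝ^d \ {0}, and assume that v is a distributional solution of ∂_t v = ½ Δ(β(v)) on (0,T) × (ℝ^d \ {0}), i.e. for every φ ∈ C_c^∞((0,T) × (ℝ^d \ {0})), ∫₀^T ∫_{ℝ^d} [ v ∂_t φ + ½ β(v) Δφ ] dx dt = 0. Set C_d := 2π^{d/2}/Γ(d/2) and w(t,ρ) := (C_d/d) ṽ(t,ρ). Then w is a distributional solution on (0,T) × (0,∞) of ∂_t w = C_d(1−d) ∂_ρ[ ρ^{1−2/d} β((d/C_d) w) ] + (C_d d/2) ∂_{ρρ}[ ρ^{2−2/d} β((d/C_d) w) ]; that is, for every ψ ∈ C_c^∞((0,T) × (0,∞)): ∫₀^T ∫₀^∞ [ w ∂_t ψ − C_d(1−d) ρ^{1−2/d} β((d/C_d) w) ∂_ρ ψ + (C_d d/2) ρ^{2−2/d}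 β((d/C_d) w) ∂_{ρρ} ψ ] dρ dt = 0. -/
open MeasureTheory Set

noncomputable section

/-- Euclidean space `ℝ^d`. -/
abbrev Euc (d : ℕ) := EuclideanSpace ℝ (Fin d)

/-- Second partial derivative `∂_{ij} φ`. -/
def pd2 {d : ℕ} (i j : Fin d) (φ : Euc d → ℝ) (x : Euc d) : ℝ :=
  fderiv ℝ (fun y => fderiv ℝ φ y (EuclideanSpace.single j 1)) x (EuclideanSpace.single i 1)

/-- The Laplacian `Δφ = Σ_i ∂_{ii} φ`. -/
def lap {d : ℕ} (φ : Euc d → ℝ) (x : Euc d) : ℝ := ∑ i, pd2 i i φ x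

/-- `C_d = 2 π^{d/2} / Γ(d/2)`, the surface measure of the unit sphere in `ℝ^d`. -/
def sphereConst (d : ℕ) : ℝ := 2 * Real.pi ^ ((d : ℝ) / 2) / Real.Gamma ((d : ℝ) / 2)

/-- The pushforward of Lebesgue measure on `ℝ^d` under `x ↦ ‖x‖ ^ d` is a multiple of Lebesgue
measure on the half-line. -/
theorem map_norm_pow_volume {d : ℕ} (hd : 1 ≤ d) :
    (volume : Measure (Euc d)).map (fun x => ‖x‖ ^ d)
      = ENNReal.ofReal (sphereConst d / d) • (volume : Measure ℝ).restrict (Ioi 0) := by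
  have hd0 : d ≠ 0 := by omega
  have : Nonempty (Fin d) := ⟨⟨0, hd⟩⟩
  have hdR : (0 : ℝ) < d := by exact_mod_cast hd
  have hmeas : Measurable (fun x : Euc d => ‖x‖ ^ d) := by fun_prop
  have hIio : ∀ b : ℝ, (volume : Measure (Euc d)).map (fun x => ‖x‖ ^ d) (Iio b)
      = (ENNReal.ofReal (sphereConst d / d) • (volume : Measure ℝ).restrict (Ioi 0)) (Iio b) := by
    intro b
    rw [Measure.map_apply hmeas measurableSet_Iio, Measure.smul_apply,
      Measure.restrict_apply measurableSet_Iio, Iio_inter_Ioi, Real.volume_Ioo, sub_zero,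
      smul_eq_mul]
    rcases le_or_gt b 0 with hb | hb
    · have : (fun x : Euc d => ‖x‖ ^ d) ⁻¹' Iio b = ∅ := by
        ext x
        simpa using hb.trans (by positivity)
      rw [this, ENNReal.ofReal_of_nonpos hb]
      simp
    · have : (fun x : Euc d => ‖x‖ ^ d) ⁻¹' Iio b = Metric.ball 0 (b ^ (d : ℝ)⁻¹) := by
        ext x
        rw [mem_preimage, mem_Iio, mem_ball_zero_iff,
          Real.lt_rpow_inv_iff_of_pos (norm_nonneg x) hb.le hdR, Real.rpow_natCast]
      have hΓ : Real.Gamma ((d : ℝ) / 2) ≠ 0 := (Real.Gamma_pos_of_pos (by positivity)).ne'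
      have hπ : √Real.pi ^ d = Real.pi ^ ((d : ℝ) / 2) := by
        rw [Real.sqrt_eq_rpow, ← Real.rpow_natCast, ← Real.rpow_mul Real.pi_pos.le]
        congr 1
        ring
      rw [this, EuclideanSpace.volume_ball, Fintype.card_fin,
        ← ENNReal.ofReal_pow (by positivity), Real.rpow_inv_natCast_pow hb.le hd0, mul_comm, hπ,
        Real.Gamma_add_one (by positivity), sphereConst]
      congr 2
      field_simp
  refine Measure.ext_of_generateFrom_of_iUnion _ (fun n : ℕ => Iio (n : ℝ))
    (borel_eq_generateFrom_Iio ℝ ▸ BorelSpace.measurable_eq) isPiSystem_Iio ?_ ?_ ?_ ?_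
  · exact iUnion_eq_univ_iff.2 fun x => exists_nat_gt x
  · exact fun n => ⟨n, rfl⟩
  · intro n
    rw [hIio, Measure.smul_apply, Measure.restrict_apply measurableSet_Iio, Iio_inter_Ioi,
      Real.volume_Ioo, smul_eq_mul]
    exact ENNReal.mul_ne_top ENNReal.ofReal_ne_top ENNReal.ofReal_ne_top
  · rintro _ ⟨b, rfl⟩
    exact hIio b

/-- The Laplacian of a function of `‖x‖ ^ 2`. -/
theorem lap_comp_norm_sq {d : ℕ} {G G₁ G₂ : ℝ → ℝ} (hG : ∀ s, 0 < s → HasDerivAt G (G₁ s) s)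
    (hG₁ : ∀ s, 0 < s → HasDerivAt G₁ (G₂ s) s) {x : Euc d} (hx : x ≠ 0) :
    lap (fun y => G (‖y‖ ^ 2)) x = 4 * ‖x‖ ^ 2 * G₂ (‖x‖ ^ 2) + 2 * d * G₁ (‖x‖ ^ 2) := by
  have hpos : ∀ y : Euc d, y ≠ 0 → 0 < ‖y‖ ^ 2 := fun y hy => by positivity
  have hn : ∀ y : Euc d, HasFDerivAt (fun z : Euc d => ‖z‖ ^ 2) (2 • innerSL ℝ y) y :=
    fun y => (hasStrictFDerivAt_norm_sq y).hasFDerivAt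
  have hpd : ∀ i, pd2 i i (fun y : Euc d => G (‖y‖ ^ 2)) x
      = 4 * x i ^ 2 * G₂ (‖x‖ ^ 2) + 2 * G₁ (‖x‖ ^ 2) := by
    intro i
    have h1 : (fun y => fderiv ℝ (fun y : Euc d => G (‖y‖ ^ 2)) y (EuclideanSpace.single i 1))
        =ᶠ[nhds x] fun y => G₁ (‖y‖ ^ 2) * (2 * y i) := by
      filter_upwards [isOpen_ne.mem_nhds hx] with y hy
      have := ((hG _ (hpos y hy)).comp_hasFDerivAt y (hn y)).fderiv
      simp only [Function.comp_def] at this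
      rw [this]
      simp [EuclideanSpace.inner_single_right]
    have hc : HasFDerivAt (fun y : Euc d => 2 * y i) ((2 : ℝ) • EuclideanSpace.proj i) x :=
      (EuclideanSpace.proj (𝕜 := ℝ) i).hasFDerivAt.const_mul 2
    have h2 := (((hG₁ _ (hpos x hx)).comp_hasFDerivAt x (hn x)).mul hc).fderiv
    rw [pd2, h1.fderiv_eq]
    simp only [Function.comp_def, Pi.mul_def] at h2
    rw [h2]
    simp [EuclideanSpace.inner_single_right]
    ring
  simp only [lap, hpd]
  simp only [Finset.sum_add_distrib, ← Finset.sum_mul, ← Finset.mul_sum,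
    ← EuclideanSpace.real_norm_sq_eq, Finset.sum_const, Finset.card_univ, Fintype.card_fin,
    nsmul_eq_mul]
  ring

/-- The Laplacian of a function of `ρ = ‖x‖ ^ d`. -/
theorem lap_comp_norm_pow {d : ℕ} (hd : 1 ≤ d) {g g₁ g₂ : ℝ → ℝ}
    (hg : ∀ s, 0 < s → HasDerivAt g (g₁ s) s)
    (hg₁ : ∀ s, 0 < s → HasDerivAt g₁ (g₂ s) s) {x : Euc d} (hx : x ≠ 0) :
    lap (fun y => g (‖y‖ ^ d)) x
      = d ^ 2 * (‖x‖ ^ d) ^ (2 - 2 / (d : ℝ)) * g₂ (‖x‖ ^ d)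
        + 2 * d * (d - 1) * (‖x‖ ^ d) ^ (1 - 2 / (d : ℝ)) * g₁ (‖x‖ ^ d) := by
  have hdR : (d : ℝ) ≠ 0 := by positivity
  set a : ℝ := d / 2 with ha
  have hda : (d : ℝ) = 2 * a := by rw [ha]; ring
  have hda' : 2 / (d : ℝ) = 1 / a := by rw [ha]; field_simp
  have ha0 : a ≠ 0 := by positivity
  have hnorm : ∀ y : Euc d, ‖y‖ ^ d = (‖y‖ ^ 2) ^ a := fun y => by
    rw [← Real.rpow_natCast, ← Real.rpow_natCast, ← Real.rpow_mul (norm_nonneg y), hda]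
    simp
  have hpow : ∀ s : ℝ, 0 < s → ∀ b : ℝ, HasDerivAt (fun s : ℝ => s ^ b) (b * s ^ (b - 1)) s :=
    fun s hs b => Real.hasDerivAt_rpow_const (Or.inl hs.ne')
  have hG : ∀ s, 0 < s → HasDerivAt (fun s : ℝ => g (s ^ a))
      (g₁ (s ^ a) * (a * s ^ (a - 1))) s := fun s hs =>
    (hg _ (by positivity)).comp s (hpow s hs a)
  have hG₁ : ∀ s, 0 < s → HasDerivAt (fun s : ℝ => g₁ (s ^ a) * (a * s ^ (a - 1)))
      (g₂ (s ^ a) * (a * s ^ (a - 1)) * (a * s ^ (a - 1))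
        + g₁ (s ^ a) * (a * ((a - 1) * s ^ (a - 1 - 1)))) s := fun s hs =>
    ((hg₁ _ (by positivity)).comp s (hpow s hs a)).mul ((hpow s hs (a - 1)).const_mul a)
  simp only [hnorm]
  rw [lap_comp_norm_sq hG hG₁ hx]
  have hs : 0 < ‖x‖ ^ 2 := by positivity
  generalize ‖x‖ ^ 2 = s at hs
  rw [hda', hda, ← Real.rpow_mul hs.le, ← Real.rpow_mul hs.le,
    show a * (2 - 1 / a) = (a - 1) + (a - 1) + 1 by field_simp; ring,
    show a * (1 - 1 / a) = (a - 1 - 1) + 1 by field_simp; ring,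
    Real.rpow_add_one hs.ne', Real.rpow_add_one hs.ne', Real.rpow_add hs]
  have h1 : s ^ (a - 1) = s ^ (a - 1 - 1) * s := by
    rw [← Real.rpow_add_one hs.ne']; congr 1; ring
  rw [h1]
  ring

/-- Composing a test function on `ℝ × (0, ∞)` with `(t, x) ↦ (t, ‖x‖ ^ d)` gives a smooth
function. -/
theorem contDiff_comp_norm_pow {d : ℕ} (hd : 1 ≤ d) {ψ : ℝ × ℝ → ℝ}
    (hψ : ContDiff ℝ (⊤ : ℕ∞) ψ) (hsupp : tsupport ψ ⊆ univ ×ˢ Ioi 0) :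
    ContDiff ℝ (⊤ : ℕ∞) fun p : ℝ × Euc d => ψ (p.1, ‖p.2‖ ^ d) := by
  have hΦ : Continuous fun p : ℝ × Euc d => (p.1, ‖p.2‖ ^ d) := by fun_prop
  refine contDiff_iff_contDiffAt.2 fun p => ?_
  by_cases hp : p.2 = 0
  · have hmem : (p.1, ‖p.2‖ ^ d) ∉ tsupport ψ := fun h => by
      have := (hsupp h).2
      simp [hp, show d ≠ 0 by omega] at this
    have hz : (fun p : ℝ × Euc d => ψ (p.1, ‖p.2‖ ^ d)) =ᶠ[nhds p] fun _ => 0 :=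
      hΦ.continuousAt.eventually (notMem_tsupport_iff_eventuallyEq.1 hmem)
    exact contDiffAt_const.congr_of_eventuallyEq hz
  · exact hψ.contDiffAt.comp p (contDiffAt_fst.prodMk ((contDiffAt_snd.norm ℝ hp).pow d))

theorem tsupport_comp_norm_pow_subset {d : ℕ} (ψ : ℝ × ℝ → ℝ) :
    tsupport (fun p : ℝ × Euc d => ψ (p.1, ‖p.2‖ ^ d))
      ⊆ (fun p : ℝ × Euc d => (p.1, ‖p.2‖ ^ d)) ⁻¹' tsupport ψ :=
  tsupport_comp_subset_preimage ψ (f := fun p : ℝ × Euc d => (p.1, ‖p.2‖ ^ d)) (by fun_prop)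

theorem hasCompactSupport_comp_norm_pow {d : ℕ} (hd : 1 ≤ d) {ψ : ℝ × ℝ → ℝ}
    (hψ : HasCompactSupport ψ) :
    HasCompactSupport fun p : ℝ × Euc d => ψ (p.1, ‖p.2‖ ^ d) := by
  obtain ⟨R, hR⟩ := hψ.isCompact.isBounded.subset_closedBall 0
  refine (isCompact_closedBall (0 : ℝ × Euc d) (max R 1)).of_isClosed_subset
    (isClosed_tsupport _) fun p hp => ?_
  have h := hR (tsupport_comp_norm_pow_subset ψ hp)
  simp only [mem_closedBall_zero_iff, Prod.norm_def, sup_le_iff, norm_pow, norm_norm] at h ⊢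
  refine ⟨h.1.trans (le_max_left _ _), ?_⟩
  rcases le_total ‖p.2‖ 1 with h1 | h1
  · exact h1.trans (le_max_right _ _)
  · exact ((le_self_pow₀ h1 (by omega)).trans h.2).trans (le_max_left _ _)

theorem deriv_fst_eq_fderiv {ψ : ℝ × ℝ → ℝ} (hψ : Differentiable ℝ ψ) (t ρ : ℝ) :
    deriv (fun τ => ψ (τ, ρ)) t = fderiv ℝ ψ (t, ρ) (1, 0) :=
  ((hψ (t, ρ)).hasFDerivAt.comp_hasDerivAt t
    ((hasDerivAt_id t).prodMk (hasDerivAt_const t ρ))).deriv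

theorem hasDerivAt_snd {ψ : ℝ × ℝ → ℝ} (hψ : Differentiable ℝ ψ) (t ρ : ℝ) :
    HasDerivAt (fun r => ψ (t, r)) (fderiv ℝ ψ (t, ρ) (0, 1)) ρ :=
  (hψ (t, ρ)).hasFDerivAt.comp_hasDerivAt ρ
    ((hasDerivAt_const ρ t).prodMk (hasDerivAt_id ρ))

/-- **Radial reduction of the generalised porous media equation** (Proposition 5.10 of
Belaribi--Cuvelier--Russo): if `v(t,x) = ṽ(t,|x|^d)` solves `∂_t v = ½ Δ(β(v))` in the
sense of distributions on `(0,T) × (ℝ^d ∖ {0})`, then `w(t,ρ) = (C_d/d) ṽ(t,ρ)` solves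
the transformed one-dimensional Fokker--Planck type equation on `(0,T) × (0,∞)`. -/
theorem stmt8 (d : ℕ) (hd : 1 ≤ d) (T : ℝ) (hT : 0 < T)
    (β : ℝ → ℝ) (hβ : Continuous β)
    (vtilde : ℝ → ℝ → ℝ)
    (hv_meas : Measurable (Function.uncurry vtilde))
    (hv_bdd : ∃ K, ∀ t ∈ Set.Ioo (0:ℝ) T, ∀ ρ ∈ Set.Ioi (0:ℝ), |vtilde t ρ| ≤ K)
    (v : ℝ → Euc d → ℝ) (hv : ∀ t x, v t x = vtilde t (‖x‖ ^ d))
    (hsol : ∀ φ : ℝ × Euc d → ℝ, ContDiff ℝ (⊤ : ℕ∞) φ → HasCompactSupport φ →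
      tsupport φ ⊆ Set.Ioo 0 T ×ˢ ({(0 : Euc d)}ᶜ) →
      ∫ p in (Set.Ioo (0:ℝ) T ×ˢ (Set.univ : Set (Euc d))),
        (v p.1 p.2 * deriv (fun τ => φ (τ, p.2)) p.1
          + (1/2 : ℝ) * β (v p.1 p.2) * lap (fun x => φ (p.1, x)) p.2) = 0)
    (C : ℝ) (hC : C = sphereConst d)
    (w : ℝ → ℝ → ℝ) (hw : ∀ t ρ, w t ρ = C / d * vtilde t ρ) :
    ∀ ψ : ℝ × ℝ → ℝ, ContDiff ℝ (⊤ : ℕ∞) ψ → HasCompactSupport ψ →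
      tsupport ψ ⊆ Set.Ioo 0 T ×ˢ Set.Ioi (0:ℝ) →
      ∫ q in (Set.Ioo (0:ℝ) T ×ˢ Set.Ioi (0:ℝ)),
        (w q.1 q.2 * deriv (fun τ => ψ (τ, q.2)) q.1
          - C * (1 - d) * q.2 ^ (1 - 2 / (d:ℝ)) * β ((d / C) * w q.1 q.2)
              * deriv (fun ρ => ψ (q.1, ρ)) q.2
          + (C * d / 2) * q.2 ^ (2 - 2 / (d:ℝ)) * β ((d / C) * w q.1 q.2)
              * deriv (deriv (fun ρ => ψ (q.1, ρ))) q.2) = 0 := by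
  intro ψ hψ hψc hψs
  have hdR : (0 : ℝ) < d := by exact_mod_cast hd
  have : Nonempty (Fin d) := ⟨⟨0, hd⟩⟩
  have hC0 : 0 < C := by
    have := Real.Gamma_pos_of_pos (show (0 : ℝ) < d / 2 by positivity)
    rw [hC, sphereConst]
    positivity
  set ψ₁ : ℝ × ℝ → ℝ := fun q => fderiv ℝ ψ q (0, 1) with hψ₁_def
  have hψ₁ : ContDiff ℝ (⊤ : ℕ∞) ψ₁ :=
    (hψ.fderiv_right (m := (⊤ : ℕ∞)) (by simp)).clm_apply contDiff_const
  have hψd : Differentiable ℝ ψ := hψ.differentiable (by simp)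
  have hψ₁d : Differentiable ℝ ψ₁ := hψ₁.differentiable (by simp)
  have hderiv : ∀ t, deriv (fun ρ => ψ (t, ρ)) = fun ρ => ψ₁ (t, ρ) := fun t =>
    funext fun ρ => (hasDerivAt_snd hψd t ρ).deriv
  set H : ℝ × ℝ → ℝ := fun q => vtilde q.1 q.2 * fderiv ℝ ψ q (1, 0)
    + (1 / 2 : ℝ) * β (vtilde q.1 q.2) *
      (d ^ 2 * q.2 ^ (2 - 2 / (d : ℝ)) * fderiv ℝ ψ₁ q (0, 1)
        + 2 * d * (d - 1) * q.2 ^ (1 - 2 / (d : ℝ)) * ψ₁ q) with hH_def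
  have hH : Measurable H := by
    have h1 : Measurable fun q : ℝ × ℝ => vtilde q.1 q.2 := hv_meas
    have h2 : Measurable fun q => fderiv ℝ ψ q (1, 0) :=
      ((hψ.continuous_fderiv (by simp)).clm_apply continuous_const).measurable
    have h3 : Measurable fun q => fderiv ℝ ψ₁ q (0, 1) :=
      ((hψ₁.continuous_fderiv (by simp)).clm_apply continuous_const).measurable
    have h4 : Measurable ψ₁ := hψ₁.continuous.measurable
    have h5 : Measurable fun q : ℝ × ℝ => β (vtilde q.1 q.2) := hβ.measurable.comp h1
    fun_prop
  have key := hsol (fun p => ψ (p.1, ‖p.2‖ ^ d))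
    (contDiff_comp_norm_pow hd hψ (hψs.trans (prod_mono_left (subset_univ _))))
    (hasCompactSupport_comp_norm_pow hd hψc) (fun p hp => by
      have h := hψs (tsupport_comp_norm_pow_subset ψ hp)
      refine ⟨h.1, fun h0 => ?_⟩
      have h2 := h.2
      simp [mem_singleton_iff.1 h0, show d ≠ 0 by omega] at h2)
  have hne : ∀ᵐ p : ℝ × Euc d ∂(volume.restrict (Ioo (0 : ℝ) T ×ˢ (univ : Set (Euc d)))),
      p.2 ≠ 0 :=
    ae_restrict_of_ae (Measure.quasiMeasurePreserving_snd.ae (Measure.ae_ne volume 0))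
  have hpull : ∫ p in Ioo (0 : ℝ) T ×ˢ (univ : Set (Euc d)),
      H (Prod.map id (fun x : Euc d => ‖x‖ ^ d) p) = 0 := by
    refine (integral_congr_ae ?_).trans key
    filter_upwards [hne] with p hp
    simp only [hH_def, Prod.map_fst, Prod.map_snd, id, hv, deriv_fst_eq_fderiv hψd]
    rw [lap_comp_norm_pow hd (g := fun s => ψ (p.1, s)) (fun s _ => hasDerivAt_snd hψd p.1 s)
      (fun s _ => hasDerivAt_snd hψ₁d p.1 s) hp]
    rfl
  have hmeas : Measurable (fun x : Euc d => ‖x‖ ^ d) := by fun_prop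
  rw [Measure.volume_eq_prod, ← Measure.prod_restrict, Measure.restrict_univ,
    ← integral_map (φ := Prod.map id fun x : Euc d => ‖x‖ ^ d)
      (measurable_id.prodMap hmeas).aemeasurable hH.aestronglyMeasurable,
    ← Measure.map_prod_map _ _ measurable_id hmeas, Measure.map_id, map_norm_pow_volume hd,
    Measure.prod_smul_right, integral_smul_measure, ← hC,
    ENNReal.toReal_ofReal (by positivity), Measure.prod_restrict, ← Measure.volume_eq_prod,
    smul_eq_mul, ← integral_const_mul] at hpull
  refine Eq.trans (integral_congr_ae (Filter.Eventually.of_forall fun q => ?_)) hpull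
  simp only [hderiv, (hasDerivAt_snd hψ₁d q.1 q.2).deriv, deriv_fst_eq_fderiv hψd, hH_def, hw]
  field_simp
  ring

end
end

section
/- Let d ≥ 1 and γ ∈ (0,1). Then there exists a constant c > 0, depending only on d and γ, such that for every bounded measurable f : ℝ^d → ℝ with [f]_γ < ∞ and every t > 0, the function P_t f is differentiable on ℝ^d and ‖∇(P_t f)‖_∞ ≤ c t^{(γ−1)/2} [f]_γ. -/
open MeasureTheory

noncomputable section

/-- The Gaussian heat kernel `g_t(x) = (2πt)^{-d/2} exp(-|x|²/(2t))` on `ℝ^d`. -/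
def heatKernel (d : ℕ) (t : ℝ) (x : EuclideanSpace ℝ (Fin d)) : ℝ :=
  (2 * Real.pi * t) ^ (-(d : ℝ) / 2) * Real.exp (-‖x‖ ^ 2 / (2 * t))

/-- The heat semigroup `P_t f = g_t * f`. -/
def heatSemigroup (d : ℕ) (t : ℝ) (f : EuclideanSpace ℝ (Fin d) → ℝ)
    (x : EuclideanSpace ℝ (Fin d)) : ℝ :=
  ∫ y, heatKernel d t (x - y) * f y

theorem integrable_exp_neg_mul_norm_sq (d : ℕ) {b : ℝ} (hb : 0 < b) :
    Integrable fun x : EuclideanSpace ℝ (Fin d) => Real.exp (-b * ‖x‖ ^ 2) := by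
  have h := GaussianFourier.integrable_cexp_neg_mul_sq_norm_add
    (V := EuclideanSpace ℝ (Fin d)) (b := (b : ℂ)) (by simpa using hb) 0 0
  refine h.norm.congr (Filter.Eventually.of_forall fun x => ?_)
  simp only [Complex.norm_exp]
  congr 1
  simp [← Complex.ofReal_pow]

theorem continuous_heatKernel (d : ℕ) (t : ℝ) : Continuous (heatKernel d t) := by
  unfold heatKernel
  fun_prop

theorem heatKernel_nonneg (d : ℕ) {t : ℝ} (ht : 0 < t) (x : EuclideanSpace ℝ (Fin d)) :
    0 ≤ heatKernel d t x := by
  unfold heatKernel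
  positivity

theorem heatKernel_neg (d : ℕ) (t : ℝ) (x : EuclideanSpace ℝ (Fin d)) :
    heatKernel d t (-x) = heatKernel d t x := by
  simp [heatKernel]

theorem heatKernel_sqrt_smul (d : ℕ) {t : ℝ} (ht : 0 < t) (x : EuclideanSpace ℝ (Fin d)) :
    heatKernel d t (√t • x) = (√t ^ d)⁻¹ * heatKernel d 1 x := by
  have hs : (√t ^ d)⁻¹ = t ^ (-(d : ℝ) / 2) := by
    rw [Real.sqrt_eq_rpow, ← Real.rpow_natCast, ← Real.rpow_mul ht.le, ← Real.rpow_neg ht.le]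
    congr 1
    ring
  have he : -‖√t • x‖ ^ 2 / (2 * t) = -‖x‖ ^ 2 / (2 * 1) := by
    rw [norm_smul, mul_pow, Real.norm_eq_abs, sq_abs, Real.sq_sqrt ht.le]
    field_simp
  rw [heatKernel, heatKernel, he, hs, Real.mul_rpow (by positivity) ht.le]
  ring_nf

/-- Polynomial factors of degree at most two are absorbed by the Gaussian at the cost of halving
the exponent. -/
theorem exists_heatKernel_mul_le (d : ℕ) {t : ℝ} (ht : 0 < t) :
    ∃ C : ℝ, 0 ≤ C ∧ ∀ x : EuclideanSpace ℝ (Fin d),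
      heatKernel d t x * (1 + ‖x‖ ^ 2) ≤ C * Real.exp (-(1 / (4 * t)) * ‖x‖ ^ 2) := by
  refine ⟨(2 * Real.pi * t) ^ (-(d : ℝ) / 2) * (1 + 4 * t), by positivity, fun x => ?_⟩
  have h1 : Real.exp (-‖x‖ ^ 2 / (2 * t)) =
      Real.exp (-(1 / (4 * t)) * ‖x‖ ^ 2) * Real.exp (-(1 / (4 * t)) * ‖x‖ ^ 2) := by
    rw [← Real.exp_add]
    congr 1
    field_simp
    ring
  have h2 : Real.exp (-(1 / (4 * t)) * ‖x‖ ^ 2) * (1 + ‖x‖ ^ 2) ≤ 1 + 4 * t := by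
    have h3 := Real.add_one_le_exp (1 / (4 * t) * ‖x‖ ^ 2)
    have h4 : (1 : ℝ) ≤ Real.exp (1 / (4 * t) * ‖x‖ ^ 2) := Real.one_le_exp (by positivity)
    rw [neg_mul, Real.exp_neg, inv_mul_le_iff₀ (Real.exp_pos _)]
    have h5 : ‖x‖ ^ 2 = 4 * t * (1 / (4 * t) * ‖x‖ ^ 2) := by field_simp
    nlinarith
  rw [heatKernel, h1]
  calc _ = (2 * Real.pi * t) ^ (-(d : ℝ) / 2) *
        (Real.exp (-(1 / (4 * t)) * ‖x‖ ^ 2) * (1 + ‖x‖ ^ 2)) *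
          Real.exp (-(1 / (4 * t)) * ‖x‖ ^ 2) := by ring
    _ ≤ _ := by gcongr

theorem rpow_le_one_add_sq {r p : ℝ} (hr : 0 ≤ r) (hp : 0 ≤ p) (hp2 : p ≤ 2) :
    r ^ p ≤ 1 + r ^ 2 := by
  rcases le_total r 1 with h | h
  · have := Real.rpow_le_one hr h hp
    nlinarith [sq_nonneg r]
  · have := Real.rpow_le_rpow_of_exponent_le h hp2
    rw [Real.rpow_two] at this
    linarith

theorem integrable_heatKernel_mul_rpow_norm (d : ℕ) {t p : ℝ} (ht : 0 < t) (hp : 0 ≤ p)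
    (hp2 : p ≤ 2) :
    Integrable fun x : EuclideanSpace ℝ (Fin d) => heatKernel d t x * ‖x‖ ^ p := by
  obtain ⟨C, -, hC⟩ := exists_heatKernel_mul_le d ht
  refine ((integrable_exp_neg_mul_norm_sq d (b := 1 / (4 * t)) (by positivity)).const_mul C).mono'
    ((continuous_heatKernel d t).mul
      (continuous_norm.rpow_const fun _ => Or.inr hp)).aestronglyMeasurable
    (Filter.Eventually.of_forall fun x => ?_)
  rw [Real.norm_of_nonneg (mul_nonneg (heatKernel_nonneg d ht x) (by positivity))]
  exact (mul_le_mul_of_nonneg_left (rpow_le_one_add_sq (norm_nonneg x) hp hp2)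
    (heatKernel_nonneg d ht x)).trans (hC x)

theorem integral_heatKernel_mul_rpow_norm (d : ℕ) {t : ℝ} (ht : 0 < t) (p : ℝ) :
    ∫ x, heatKernel d t x * ‖x‖ ^ p = t ^ (p / 2) * ∫ x, heatKernel d 1 x * ‖x‖ ^ p := by
  have hs : 0 < √t := Real.sqrt_pos.2 ht
  have h := Measure.integral_comp_smul_of_nonneg (volume : Measure (EuclideanSpace ℝ (Fin d)))
    (fun x => heatKernel d t x * ‖x‖ ^ p) (√t) (hR := hs.le)
  have hpt : ∀ x : EuclideanSpace ℝ (Fin d), heatKernel d t (√t • x) * ‖√t • x‖ ^ p =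
      (√t ^ d)⁻¹ * (t ^ (p / 2) * (heatKernel d 1 x * ‖x‖ ^ p)) := fun x => by
    rw [heatKernel_sqrt_smul d ht, norm_smul, Real.norm_of_nonneg hs.le,
      Real.mul_rpow hs.le (norm_nonneg x), Real.sqrt_eq_rpow, ← Real.rpow_mul ht.le]
    ring_nf
  simp only [hpt, integral_const_mul, finrank_euclideanSpace_fin, smul_eq_mul] at h
  exact (mul_left_cancel₀ (by positivity) h).symm

/-- The gradient of the heat kernel, as a continuous linear form. -/
def heatKernelDeriv (d : ℕ) (t : ℝ) (x : EuclideanSpace ℝ (Fin d)) :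
    EuclideanSpace ℝ (Fin d) →L[ℝ] ℝ :=
  (-(heatKernel d t x / t)) • innerSL ℝ x

theorem hasFDerivAt_heatKernel (d : ℕ) {t : ℝ} (ht : 0 < t) (x : EuclideanSpace ℝ (Fin d)) :
    HasFDerivAt (heatKernel d t) (heatKernelDeriv d t x) x := by
  have h := (((hasStrictFDerivAt_norm_sq x).hasFDerivAt.const_mul (-(1 / (2 * t)))).exp).const_mul
    ((2 * Real.pi * t) ^ (-(d : ℝ) / 2))
  have hexp : ∀ y : EuclideanSpace ℝ (Fin d),
      -(1 / (2 * t)) * ‖y‖ ^ 2 = -‖y‖ ^ 2 / (2 * t) := fun y => by ring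
  simp only [hexp] at h
  refine HasFDerivAt.congr_fderiv (f := heatKernel d t) h ?_
  ext y
  simp [heatKernelDeriv, heatKernel]
  field_simp

theorem continuous_heatKernelDeriv (d : ℕ) (t : ℝ) : Continuous (heatKernelDeriv d t) := by
  unfold heatKernelDeriv
  exact ((continuous_heatKernel d t).div_const t).neg.smul (innerSL ℝ).continuous

theorem norm_heatKernelDeriv (d : ℕ) {t : ℝ} (ht : 0 < t) (x : EuclideanSpace ℝ (Fin d)) :
    ‖heatKernelDeriv d t x‖ = heatKernel d t x * ‖x‖ / t := by
  rw [heatKernelDeriv, norm_smul, innerSL_apply_norm, norm_neg,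
    Real.norm_of_nonneg (div_nonneg (heatKernel_nonneg d ht x) ht.le)]
  ring

theorem heatKernelDeriv_neg (d : ℕ) (t : ℝ) (x : EuclideanSpace ℝ (Fin d)) :
    heatKernelDeriv d t (-x) = -heatKernelDeriv d t x := by
  simp [heatKernelDeriv, heatKernel_neg]

theorem integral_heatKernelDeriv (d : ℕ) (t : ℝ) : ∫ x, heatKernelDeriv d t x = 0 := by
  have h := integral_neg_eq_self (heatKernelDeriv d t) volume
  simp only [heatKernelDeriv_neg, integral_neg] at h
  have := IsAddTorsionFree.of_module_rat (EuclideanSpace ℝ (Fin d) →L[ℝ] ℝ)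
  exact self_eq_neg.1 h.symm

theorem integrable_heatKernelDeriv (d : ℕ) {t : ℝ} (ht : 0 < t) :
    Integrable (heatKernelDeriv d t) := by
  refine ((integrable_heatKernel_mul_rpow_norm d ht zero_le_one one_le_two).div_const t).mono'
    (continuous_heatKernelDeriv d t).aestronglyMeasurable (Filter.Eventually.of_forall fun x => ?_)
  rw [norm_heatKernelDeriv d ht, Real.rpow_one]

theorem exists_norm_heatKernelDeriv_le (d : ℕ) {t : ℝ} (ht : 0 < t) :
    ∃ C : ℝ, 0 ≤ C ∧ ∀ u v : EuclideanSpace ℝ (Fin d), ‖u - v‖ ≤ 1 →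
      ‖heatKernelDeriv d t u‖ ≤ C * Real.exp (-(1 / (8 * t)) * ‖v‖ ^ 2) := by
  obtain ⟨C, hC0, hC⟩ := exists_heatKernel_mul_le d ht
  refine ⟨C / t * Real.exp (1 / (4 * t)), by positivity, fun u v huv => ?_⟩
  have h1 : heatKernel d t u * ‖u‖ ≤ C * Real.exp (-(1 / (4 * t)) * ‖u‖ ^ 2) :=
    (mul_le_mul_of_nonneg_left (by nlinarith [sq_nonneg (‖u‖ - 1)])
      (heatKernel_nonneg d ht u)).trans (hC u)
  have h2 : ‖v‖ ≤ ‖u‖ + 1 := by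
    have := norm_sub_norm_le v u
    rw [norm_sub_rev] at this
    linarith
  have h3 : -(1 / (4 * t)) * ‖u‖ ^ 2 ≤ 1 / (4 * t) + -(1 / (8 * t)) * ‖v‖ ^ 2 := by
    have h4 : ‖v‖ ^ 2 ≤ 2 * ‖u‖ ^ 2 + 2 := by
      nlinarith [sq_nonneg (‖u‖ - 1), norm_nonneg v, norm_nonneg u]
    have h5 : 0 < 1 / (8 * t) := by positivity
    have h6 : 1 / (4 * t) = 2 * (1 / (8 * t)) := by field_simp; norm_num
    rw [h6]
    nlinarith
  rw [norm_heatKernelDeriv d ht]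
  calc heatKernel d t u * ‖u‖ / t
      ≤ C * Real.exp (1 / (4 * t) + -(1 / (8 * t)) * ‖v‖ ^ 2) / t := by
        refine div_le_div_of_nonneg_right (h1.trans ?_) ht.le
        gcongr
    _ = _ := by
        rw [Real.exp_add]
        ring

theorem hasFDerivAt_heatSemigroup (d : ℕ) {t : ℝ} (ht : 0 < t)
    {f : EuclideanSpace ℝ (Fin d) → ℝ} (hf : Measurable f) {M : ℝ} (hM : ∀ x, |f x| ≤ M)
    (x : EuclideanSpace ℝ (Fin d)) :
    HasFDerivAt (heatSemigroup d t f) (∫ y, f y • heatKernelDeriv d t (x - y)) x := by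
  obtain ⟨C, hC0, hC⟩ := exists_norm_heatKernelDeriv_le d ht
  have hsub : ∀ z : EuclideanSpace ℝ (Fin d), Continuous fun y => z - y := fun z => by fun_prop
  have hM0 : 0 ≤ M := (abs_nonneg _).trans (hM 0)
  refine hasFDerivAt_integral_of_dominated_of_fderiv_le (Metric.ball_mem_nhds x one_pos)
    (F' := fun z y => f y • heatKernelDeriv d t (z - y))
    (bound := fun y => M * (C * Real.exp (-(1 / (8 * t)) * ‖x - y‖ ^ 2))) ?_ ?_ ?_ ?_ ?_ ?_
  · exact Filter.Eventually.of_forall fun z =>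
      (((continuous_heatKernel d t).comp (hsub z)).measurable.mul hf).aestronglyMeasurable
  · have h := (integrable_heatKernel_mul_rpow_norm d ht le_rfl zero_le_two).comp_sub_left x
    simp only [Real.rpow_zero, mul_one] at h
    exact h.mul_bdd hf.aestronglyMeasurable (Filter.Eventually.of_forall hM)
  · exact hf.aestronglyMeasurable.smul
      ((continuous_heatKernelDeriv d t).comp (hsub x)).aestronglyMeasurable
  · refine Filter.Eventually.of_forall fun y z hz => ?_
    rw [norm_smul]
    refine mul_le_mul (hM y) (hC _ _ ?_) (norm_nonneg _) hM0
    rw [sub_sub_sub_cancel_right, ← dist_eq_norm]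
    exact (Metric.mem_ball.1 hz).le
  · exact (((integrable_exp_neg_mul_norm_sq d (by positivity)).comp_sub_left x).const_mul
      C).const_mul M
  · refine Filter.Eventually.of_forall fun y z _ => ?_
    have h := ((hasFDerivAt_heatKernel d ht (z - y)).comp z
      ((hasFDerivAt_id z).sub_const y)).mul_const (f y)
    exact h.congr_fderiv (by ext; simp)

theorem norm_integral_smul_heatKernelDeriv_le (d : ℕ) {t γ Cf : ℝ} (ht : 0 < t)
    (hγ : γ ∈ Set.Ioo (0 : ℝ) 1) {f : EuclideanSpace ℝ (Fin d) → ℝ} (hf : Measurable f) {M : ℝ}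
    (hM : ∀ x, |f x| ≤ M) (hCf : ∀ x y, |f x - f y| ≤ Cf * ‖x - y‖ ^ γ)
    (x : EuclideanSpace ℝ (Fin d)) :
    ‖∫ y, f y • heatKernelDeriv d t (x - y)‖ ≤
      (∫ z : EuclideanSpace ℝ (Fin d), heatKernel d 1 z * ‖z‖ ^ (γ + 1)) *
        t ^ ((γ - 1) / 2) * Cf := by
  have hK : Integrable fun y => heatKernelDeriv d t (x - y) :=
    (integrable_heatKernelDeriv d ht).comp_sub_left x
  have hint : Integrable fun y => f y • heatKernelDeriv d t (x - y) :=
    hK.bdd_smul M hf.aestronglyMeasurable (Filter.Eventually.of_forall hM)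
  have hcancel : ∫ y, f y • heatKernelDeriv d t (x - y) =
      ∫ y, (f y - f x) • heatKernelDeriv d t (x - y) := by
    have hsmul : ∀ y, (f y - f x) • heatKernelDeriv d t (x - y) =
        f y • heatKernelDeriv d t (x - y) - f x • heatKernelDeriv d t (x - y) :=
      fun y => by ext; simp [sub_mul]
    simp only [hsmul]
    have hKx : Integrable fun y => f x • heatKernelDeriv d t (x - y) := hK.smul (f x)
    rw [integral_sub hint hKx, integral_smul,
      integral_sub_left_eq_self (heatKernelDeriv d t) volume x, integral_heatKernelDeriv,
      smul_zero, sub_zero]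
  have hmom := integrable_heatKernel_mul_rpow_norm d ht (p := γ + 1) (by linarith [hγ.1])
    (by linarith [hγ.2])
  rw [hcancel]
  calc _ ≤ ∫ y, Cf / t * (heatKernel d t (x - y) * ‖x - y‖ ^ (γ + 1)) := by
        refine norm_integral_le_of_norm_le ((hmom.comp_sub_left x).const_mul _)
          (Filter.Eventually.of_forall fun y => ?_)
        rw [norm_smul, norm_heatKernelDeriv d ht, Real.norm_eq_abs, abs_sub_comm,
          Real.rpow_add_one' (norm_nonneg _) (by linarith [hγ.1])]
        calc _ ≤ Cf * ‖x - y‖ ^ γ * (heatKernel d t (x - y) * ‖x - y‖ / t) :=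
              mul_le_mul_of_nonneg_right (hCf x y)
                (div_nonneg (mul_nonneg (heatKernel_nonneg d ht _) (norm_nonneg _)) ht.le)
          _ = _ := by ring
    _ = Cf / t * (t ^ ((γ + 1) / 2) *
          ∫ z : EuclideanSpace ℝ (Fin d), heatKernel d 1 z * ‖z‖ ^ (γ + 1)) := by
        rw [integral_const_mul, integral_sub_left_eq_self
          (fun z : EuclideanSpace ℝ (Fin d) => heatKernel d t z * ‖z‖ ^ (γ + 1)) volume x,
          integral_heatKernel_mul_rpow_norm d ht]
    _ = _ := by
        have h : t ^ ((γ - 1) / 2) = t ^ ((γ + 1) / 2) / t := by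
          rw [← Real.rpow_sub_one ht.ne']
          congr 1
          ring
        rw [h]
        ring

/-- **Gradient Schauder estimate** `‖∇(P_t f)‖_∞ ≤ c t^{(γ-1)/2} [f]_γ` (Lemma 5.4 of the
paper, in classical Hölder spaces), obtained from the Schauder and Bernstein
inequalities. -/
theorem stmt14 (d : ℕ) (hd : 1 ≤ d) (γ : ℝ) (hγ : γ ∈ Set.Ioo (0:ℝ) 1) :
    ∃ c : ℝ, 0 < c ∧ ∀ f : EuclideanSpace ℝ (Fin d) → ℝ, Measurable f →
      (∃ M, ∀ x, |f x| ≤ M) →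
      ∀ Cf : ℝ, 0 ≤ Cf → (∀ x y, |f x - f y| ≤ Cf * ‖x - y‖ ^ γ) →
      ∀ t : ℝ, 0 < t →
        Differentiable ℝ (heatSemigroup d t f) ∧
        ∀ x, ‖fderiv ℝ (heatSemigroup d t f) x‖ ≤ c * t ^ ((γ - 1) / 2) * Cf := by
  have hI : 0 ≤ ∫ z : EuclideanSpace ℝ (Fin d), heatKernel d 1 z * ‖z‖ ^ (γ + 1) :=
    integral_nonneg fun z => mul_nonneg (heatKernel_nonneg d one_pos z) (by positivity)
  refine ⟨1 + ∫ z : EuclideanSpace ℝ (Fin d), heatKernel d 1 z * ‖z‖ ^ (γ + 1), by linarith, ?_⟩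
  rintro f hf ⟨M, hM⟩ Cf hCf0 hCf t ht
  have hderiv := hasFDerivAt_heatSemigroup d ht hf hM
  refine ⟨fun x => (hderiv x).differentiableAt, fun x => ?_⟩
  rw [(hderiv x).fderiv]
  refine (norm_integral_smul_heatKernelDeriv_le d ht hγ hf hM hCf x).trans ?_
  gcongr
  linarith

end
end
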